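/- The genus 2 Macdonald operator O_{A_1} decomposes into single-variable dual Toda Hamiltonians: for every rational function f of (x_{12},x_{13},x_{23}) over ℚ(q,t) one has O_{A_1} f = t^{−1}·Ĥ_0^{(12)}Ĥ_0^{(13)} f − (x_{23}+x_{23}^{−1})·Ĥ_1^{(12)}Ĥ_1^{(13)} f + t·Ĥ_2^{(12)}Ĥ_2^{(13)} f, where Ĥ_n^{(ij)} acts in the single variable x_{ij} by (Ĥ_n^{(ij)} g) = (x_{ij}^n/(1−x_{ij}^2))·g|_{x_{ij}→q x_{ij}} + (x_{ij}^{−n}/(1−x_{ij}^{−2}))·g|_{x_{ij}→q^{−1} x_{ij}}. The analogous identities hold for O_{A_2} and O_{A_3} after permuting the indices 1,2,3. -/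

import Mathlib

/-!
STATEMENT 13: The genus 2 Macdonald operator `O_{A₁}` decomposes into single-variable dual
Toda Hamiltonians:
`O_{A₁} f = t⁻¹·Ĥ₀^{(12)}Ĥ₀^{(13)} f − (x₂₃+x₂₃⁻¹)·Ĥ₁^{(12)}Ĥ₁^{(13)} f + t·Ĥ₂^{(12)}Ĥ₂^{(13)} f`,
and the analogous identities hold for `O_{A₂}` and `O_{A₃}` after permuting the indices.

We realize `ℚ(q,t)(x₁₂,x₁₃,x₂₃)` as the fivefold iterated `RatFunc` over `ℚ` (variables,
from innermost to outermost: `q, t, x₁₂, x₁₃, x₂₃`). Rational functions of the three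
variables are represented as functions `F → F → F → F` (arguments `x₁₂, x₁₃, x₂₃`), and
the operator identities are stated at the generic point `(x₁₂, x₁₃, x₂₃)` (equivalent to
the identities of rational functions).
-/

noncomputable section

abbrev F0 : Type := RatFunc ℚ
instance i0 : Field F0 := inferInstance
abbrev F1 : Type := RatFunc F0
instance i1 : Field F1 := inferInstance
abbrev F2 : Type := RatFunc F1
instance i2 : Field F2 := inferInstance
abbrev F3 : Type := RatFunc F2
instance i3 : Field F3 := inferInstance

/-- The field `ℚ(q,t)(x₁₂,x₁₃,x₂₃)`. -/
abbrev F : Type := RatFunc F3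
instance i4 : Field F := inferInstance

/-- The element `q`. -/
def q : F := RatFunc.C (RatFunc.C (RatFunc.C (RatFunc.C RatFunc.X)))

/-- The element `t`. -/
def t : F := RatFunc.C (RatFunc.C (RatFunc.C RatFunc.X))

/-- The generic point `x₁₂`. -/
def x12 : F := RatFunc.C (RatFunc.C RatFunc.X)

/-- The generic point `x₁₃`. -/
def x13 : F := RatFunc.C RatFunc.X

/-- The generic point `x₂₃`. -/
def x23 : F := RatFunc.X

/-- The dual Toda Hamiltonian `Ĥ_n^{(12)}` acting in the first variable. -/
def H12 (n : ℤ) (f : F → F → F → F) : F → F → F → F := fun a b c =>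
  a ^ n / (1 - a ^ 2) * f (q * a) b c + a ^ (-n) / (1 - a ^ (-2 : ℤ)) * f (q⁻¹ * a) b c

/-- The dual Toda Hamiltonian `Ĥ_n^{(13)}` acting in the second variable. -/
def H13 (n : ℤ) (f : F → F → F → F) : F → F → F → F := fun a b c =>
  b ^ n / (1 - b ^ 2) * f a (q * b) c + b ^ (-n) / (1 - b ^ (-2 : ℤ)) * f a (q⁻¹ * b) c

/-- The dual Toda Hamiltonian `Ĥ_n^{(23)}` acting in the third variable. -/
def H23 (n : ℤ) (f : F → F → F → F) : F → F → F → F := fun a b c =>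
  c ^ n / (1 - c ^ 2) * f a b (q * c) + c ^ (-n) / (1 - c ^ (-2 : ℤ)) * f a b (q⁻¹ * c)

/-- The Arthamonov–Shakirov operator `O_{A₁}` (shifting `x₁₂` and `x₁₃`). -/
def OA1 (f : F → F → F → F) : F → F → F → F := fun a b c =>
  (1 - t * a * b * c) * (1 - t * a * b * c⁻¹) / (t * a * b * (a - a⁻¹) * (b - b⁻¹))
      * f (q * a) (q * b) c
  - (1 - t * a * b⁻¹ * c) * (1 - t * a * b⁻¹ * c⁻¹) / (t * a * b⁻¹ * (a - a⁻¹) * (b - b⁻¹))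
      * f (q * a) (q⁻¹ * b) c
  - (1 - t * a⁻¹ * b * c) * (1 - t * a⁻¹ * b * c⁻¹) / (t * a⁻¹ * b * (a - a⁻¹) * (b - b⁻¹))
      * f (q⁻¹ * a) (q * b) c
  + (1 - t * a⁻¹ * b⁻¹ * c) * (1 - t * a⁻¹ * b⁻¹ * c⁻¹) / (t * a⁻¹ * b⁻¹ * (a - a⁻¹) * (b - b⁻¹))
      * f (q⁻¹ * a) (q⁻¹ * b) c

/-- The Arthamonov–Shakirov operator `O_{A₂}` (shifting `x₁₂` and `x₂₃`). -/
def OA2 (f : F → F → F → F) : F → F → F → F := fun a b c =>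
  (1 - t * a * c * b) * (1 - t * a * c * b⁻¹) / (t * a * c * (a - a⁻¹) * (c - c⁻¹))
      * f (q * a) b (q * c)
  - (1 - t * a * c⁻¹ * b) * (1 - t * a * c⁻¹ * b⁻¹) / (t * a * c⁻¹ * (a - a⁻¹) * (c - c⁻¹))
      * f (q * a) b (q⁻¹ * c)
  - (1 - t * a⁻¹ * c * b) * (1 - t * a⁻¹ * c * b⁻¹) / (t * a⁻¹ * c * (a - a⁻¹) * (c - c⁻¹))
      * f (q⁻¹ * a) b (q * c)
  + (1 - t * a⁻¹ * c⁻¹ * b) * (1 - t * a⁻¹ * c⁻¹ * b⁻¹) / (t * a⁻¹ * c⁻¹ * (a - a⁻¹) * (c - c⁻¹))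
      * f (q⁻¹ * a) b (q⁻¹ * c)

/-- The Arthamonov–Shakirov operator `O_{A₃}` (shifting `x₁₃` and `x₂₃`). -/
def OA3 (f : F → F → F → F) : F → F → F → F := fun a b c =>
  (1 - t * b * c * a) * (1 - t * b * c * a⁻¹) / (t * b * c * (b - b⁻¹) * (c - c⁻¹))
      * f a (q * b) (q * c)
  - (1 - t * b * c⁻¹ * a) * (1 - t * b * c⁻¹ * a⁻¹) / (t * b * c⁻¹ * (b - b⁻¹) * (c - c⁻¹))
      * f a (q * b) (q⁻¹ * c)
  - (1 - t * b⁻¹ * c * a) * (1 - t * b⁻¹ * c * a⁻¹) / (t * b⁻¹ * c * (b - b⁻¹) * (c - c⁻¹))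
      * f a (q⁻¹ * b) (q * c)
  + (1 - t * b⁻¹ * c⁻¹ * a) * (1 - t * b⁻¹ * c⁻¹ * a⁻¹) / (t * b⁻¹ * c⁻¹ * (b - b⁻¹) * (c - c⁻¹))
      * f a (q⁻¹ * b) (q⁻¹ * c)

theorem ratX_sq_ne_one (K : Type*) [Field K] : (RatFunc.X : RatFunc K) ^ 2 ≠ 1 := by
  intro h
  have h2 : ((Polynomial.X : Polynomial K) ^ 2) = 1 := by
    apply RatFunc.algebraMap_injective K
    simpa using h
  have h3 := congrArg Polynomial.natDegree h2
  simp at h3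

theorem t_ne : t ≠ 0 := by
  unfold t
  simp [RatFunc.X_ne_zero]

theorem x12_ne : x12 ≠ 0 := by
  unfold x12
  simp [RatFunc.X_ne_zero]

theorem x13_ne : x13 ≠ 0 := by
  unfold x13
  simp [RatFunc.X_ne_zero]

theorem x23_ne : x23 ≠ 0 := RatFunc.X_ne_zero

theorem x23_sq : x23 ^ 2 ≠ 1 := ratX_sq_ne_one _

theorem ratC_sq_ne_one {K : Type*} [Field K] (y : K) (hy : y ^ 2 ≠ 1) :
    (RatFunc.C y : RatFunc K) ^ 2 ≠ 1 := by
  intro h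
  apply hy
  apply (RatFunc.C : K →+* RatFunc K).injective
  rw [map_pow, map_one, h]

theorem x13_sq : x13 ^ 2 ≠ 1 := ratC_sq_ne_one _ (ratX_sq_ne_one _)

theorem x12_sq : x12 ^ 2 ≠ 1 := ratC_sq_ne_one _ (ratC_sq_ne_one _ (ratX_sq_ne_one _))

/-- The coefficient identity for one term. -/
theorem coeff_id {K : Type*} [Field K] (s u v c : K) (hs : s ≠ 0) (hu : u ≠ 0) (hv : v ≠ 0)
    (hc : c ≠ 0) (hu2 : u ^ 2 ≠ 1) (hv2 : v ^ 2 ≠ 1) :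
    (1 - s * u * v * c) * (1 - s * u * v * c⁻¹) / (s * u * v * (u - u⁻¹) * (v - v⁻¹))
      = s⁻¹ * (1 / (1 - u ^ 2) * (1 / (1 - v ^ 2)))
        - (c + c⁻¹) * (u / (1 - u ^ 2) * (v / (1 - v ^ 2)))
        + s * (u ^ 2 / (1 - u ^ 2) * (v ^ 2 / (1 - v ^ 2))) := by
  have h1 : 1 - u ^ 2 ≠ 0 := sub_ne_zero.mpr hu2.symm
  have h2 : 1 - v ^ 2 ≠ 0 := sub_ne_zero.mpr hv2.symm
  have e : s * u * v * (u - u⁻¹) * (v - v⁻¹) = s * (1 - u ^ 2) * (1 - v ^ 2) := by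
    field_simp
    ring
  rw [e]
  field_simp
  ring

theorem main_id {K : Type*} [Field K] (s a b c p1 p2 p3 p4 : K) (hs : s ≠ 0) (ha : a ≠ 0)
    (hb : b ≠ 0) (hc : c ≠ 0) (ha2 : a ^ 2 ≠ 1) (hb2 : b ^ 2 ≠ 1) :
    (1 - s * a * b * c) * (1 - s * a * b * c⁻¹) / (s * a * b * (a - a⁻¹) * (b - b⁻¹)) * p1
    - (1 - s * a * b⁻¹ * c) * (1 - s * a * b⁻¹ * c⁻¹)
        / (s * a * b⁻¹ * (a - a⁻¹) * (b - b⁻¹)) * p2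
    - (1 - s * a⁻¹ * b * c) * (1 - s * a⁻¹ * b * c⁻¹)
        / (s * a⁻¹ * b * (a - a⁻¹) * (b - b⁻¹)) * p3
    + (1 - s * a⁻¹ * b⁻¹ * c) * (1 - s * a⁻¹ * b⁻¹ * c⁻¹)
        / (s * a⁻¹ * b⁻¹ * (a - a⁻¹) * (b - b⁻¹)) * p4
    = s⁻¹ * (a ^ (0 : ℤ) / (1 - a ^ 2) * (b ^ (0 : ℤ) / (1 - b ^ 2) * p1
              + b ^ (-0 : ℤ) / (1 - b ^ (-2 : ℤ)) * p2)
            + a ^ (-0 : ℤ) / (1 - a ^ (-2 : ℤ)) * (b ^ (0 : ℤ) / (1 - b ^ 2) * p3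
              + b ^ (-0 : ℤ) / (1 - b ^ (-2 : ℤ)) * p4))
      - (c + c⁻¹) * (a ^ (1 : ℤ) / (1 - a ^ 2) * (b ^ (1 : ℤ) / (1 - b ^ 2) * p1
              + b ^ (-1 : ℤ) / (1 - b ^ (-2 : ℤ)) * p2)
            + a ^ (-1 : ℤ) / (1 - a ^ (-2 : ℤ)) * (b ^ (1 : ℤ) / (1 - b ^ 2) * p3
              + b ^ (-1 : ℤ) / (1 - b ^ (-2 : ℤ)) * p4))
      + s * (a ^ (2 : ℤ) / (1 - a ^ 2) * (b ^ (2 : ℤ) / (1 - b ^ 2) * p1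
              + b ^ (-2 : ℤ) / (1 - b ^ (-2 : ℤ)) * p2)
            + a ^ (-2 : ℤ) / (1 - a ^ (-2 : ℤ)) * (b ^ (2 : ℤ) / (1 - b ^ 2) * p3
              + b ^ (-2 : ℤ) / (1 - b ^ (-2 : ℤ)) * p4)) := by
  have ha' : a⁻¹ ≠ 0 := inv_ne_zero ha
  have hb' : b⁻¹ ≠ 0 := inv_ne_zero hb
  have ha2' : a⁻¹ ^ 2 ≠ 1 := by rwa [inv_pow, ne_eq, inv_eq_one]
  have hb2' : b⁻¹ ^ 2 ≠ 1 := by rwa [inv_pow, ne_eq, inv_eq_one]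
  have za : a ^ (-2 : ℤ) = a⁻¹ ^ 2 := by rw [inv_pow, zpow_neg]; norm_cast
  have zb : b ^ (-2 : ℤ) = b⁻¹ ^ 2 := by rw [inv_pow, zpow_neg]; norm_cast
  have za2 : a ^ (2 : ℤ) = a ^ 2 := by norm_cast
  have zb2 : b ^ (2 : ℤ) = b ^ 2 := by norm_cast
  have e1 := coeff_id s a b c hs ha hb hc ha2 hb2
  have e2 := coeff_id s a b⁻¹ c hs ha hb' hc ha2 hb2'
  have e3 := coeff_id s a⁻¹ b c hs ha' hb hc ha2' hb2
  have e4 := coeff_id s a⁻¹ b⁻¹ c hs ha' hb' hc ha2' hb2'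
  rw [inv_inv] at e2 e3 e4
  try rw [inv_inv] at e4
  have d2 : s * a * b⁻¹ * (a - a⁻¹) * (b⁻¹ - b) = -(s * a * b⁻¹ * (a - a⁻¹) * (b - b⁻¹)) := by ring
  have d3 : s * a⁻¹ * b * (a⁻¹ - a) * (b - b⁻¹) = -(s * a⁻¹ * b * (a - a⁻¹) * (b - b⁻¹)) := by ring
  have d4 : s * a⁻¹ * b⁻¹ * (a⁻¹ - a) * (b⁻¹ - b)
      = s * a⁻¹ * b⁻¹ * (a - a⁻¹) * (b - b⁻¹) := by ring
  rw [d2, div_neg] at e2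
  rw [d3, div_neg] at e3
  rw [d4] at e4
  rw [za, zb, za2, zb2, neg_zero, zpow_zero, zpow_zero, zpow_one, zpow_one, zpow_neg_one,
    zpow_neg_one]
  linear_combination p1 * e1 + p2 * e2 + p3 * e3 + p4 * e4

/-- The decomposition of the genus 2 Macdonald operators into dual Toda Hamiltonians. -/
theorem genus2_operator_decomposition (f : F → F → F → F) :
    (OA1 f x12 x13 x23
      = t⁻¹ * H12 0 (H13 0 f) x12 x13 x23
        - (x23 + x23⁻¹) * H12 1 (H13 1 f) x12 x13 x23
        + t * H12 2 (H13 2 f) x12 x13 x23) ∧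
    (OA2 f x12 x13 x23
      = t⁻¹ * H12 0 (H23 0 f) x12 x13 x23
        - (x13 + x13⁻¹) * H12 1 (H23 1 f) x12 x13 x23
        + t * H12 2 (H23 2 f) x12 x13 x23) ∧
    (OA3 f x12 x13 x23
      = t⁻¹ * H13 0 (H23 0 f) x12 x13 x23
        - (x12 + x12⁻¹) * H13 1 (H23 1 f) x12 x13 x23
        + t * H13 2 (H23 2 f) x12 x13 x23) := by
  refine ⟨?_, ?_, ?_⟩
  · exact main_id t x12 x13 x23 _ _ _ _ t_ne x12_ne x13_ne x23_ne x12_sq x13_sq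
  · exact main_id t x12 x23 x13 _ _ _ _ t_ne x12_ne x23_ne x13_ne x12_sq x23_sq
  · exact main_id t x13 x23 x12 _ _ _ _ t_ne x13_ne x23_ne x12_ne x13_sq x23_sq

end
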